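/- arXiv:2203.03873 — 2 statements merged into one kernel-verified Lean document; each statement's English description precedes it below -/
import Mathlib

section
/- Let λ₁, λ₂ be coprime positive integers with λ₁ ≡ λ₂ + 1 (mod 3) and S = {0, λ₁, λ₁+λ₂}. Then every S-free set A ⊆ ℤ has upper density at most ⌊(2/3)(2λ₁+λ₂)⌋/(2λ₁+λ₂), i.e., d_f(S) ≤ ⌊(2/3)(2λ₁+λ₂)⌋/(2λ₁+λ₂). -/
open Filter Set

/-- The translateSet `S + t` of a set of integers. -/
def translateSet (S : Set ℤ) (t : ℤ) : Set ℤ := (· + t) '' S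

/-- Upper density of a set of integers. -/
noncomputable def upperDensity (A : Set ℤ) : ℝ :=
  Filter.limsup (fun n : ℕ => ((A ∩ Set.Icc (-(n : ℤ)) (n : ℤ)).ncard : ℝ) / (2 * n + 1)) Filter.atTop

/-- Lower density of a set of integers. -/
noncomputable def lowerDensity (A : Set ℤ) : ℝ :=
  Filter.liminf (fun n : ℕ => ((A ∩ Set.Icc (-(n : ℤ)) (n : ℤ)).ncard : ℝ) / (2 * n + 1)) Filter.atTop

/-- `A` is `S`-covering: every integer lies in some translateSet `S + a`, `a ∈ A`. -/
def SCovering (S A : Set ℤ) : Prop := ∀ t : ℤ, ∃ a ∈ A, t ∈ translateSet S a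

/-- `A` is `S`-blocking: `A` meets every translateSet of `S`. -/
def SBlocking (S A : Set ℤ) : Prop := ∀ t : ℤ, (A ∩ translateSet S t).Nonempty

/-- `A` is `S`-free: `A` contains no translateSet of `S`. -/
def SFree (S A : Set ℤ) : Prop := ∀ t : ℤ, ¬ translateSet S t ⊆ A

/-- `A` is `S`-packing: distinct translates `S + a₁`, `S + a₂` with `a₁, a₂ ∈ A` are disjoint. -/
def SPacking (S A : Set ℤ) : Prop :=
  ∀ a₁ ∈ A, ∀ a₂ ∈ A, a₁ ≠ a₂ → Disjoint (translateSet S a₁) (translateSet S a₂)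

/-- Maximum packing density of `S`. -/
noncomputable def dP (S : Set ℤ) : ℝ := sSup (upperDensity '' {A | SPacking S A})

/-- Minimum covering density of `S`. -/
noncomputable def dC (S : Set ℤ) : ℝ := sInf (lowerDensity '' {A | SCovering S A})

/-- Minimum blocking density of `S`. -/
noncomputable def dB (S : Set ℤ) : ℝ := sInf (lowerDensity '' {A | SBlocking S A})

/-- `d_f(S)`: supremum of upper densities of `S`-free sets. -/
noncomputable def dF (S : Set ℤ) : ℝ := sSup (upperDensity '' {A | SFree S A})

/-- `d_f(S, -S)`: supremum of upper densities of sets free of translates of both `S` and `-S`. -/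
noncomputable def dF2 (S : Set ℤ) : ℝ := sSup (upperDensity '' {A | SFree S A ∧ SFree (-S) A})

/-- If `f` is a `0`-`1` sequence hitting every triple `{i, i + p, i + p + q}`, then twice its sum
over a window of length `2p + q` plus its sum over that window shifted by `p + q` is at least the
length of the window. -/
theorem two_mul_window_add_shifted_window_ge (p q : ℕ) (f : ℕ → ℤ) (h0 : ∀ i, 0 ≤ f i)
    (h1 : ∀ i, f i ≤ 1) (hf : ∀ i, 1 ≤ f i + f (i + p) + f (i + p + q)) :
    ((2 * p + q : ℕ) : ℤ) ≤ 2 * ∑ i ∈ Finset.range (2 * p + q), f i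
      + ∑ i ∈ Finset.range (2 * p + q), f (i + p + q) := by
  have hbit : ∀ i, f i = 0 ∨ f i = 1 := fun i => by
    have := h0 i; have := h1 i; omega
  have hshift : ∑ i ∈ Finset.range (2 * p + q), f (i + p) + ∑ i ∈ Finset.range p, f i
      = ∑ i ∈ Finset.range (2 * p + q), f i + ∑ i ∈ Finset.range p, f (i + (2 * p + q)) := by
    have e := (Finset.sum_range_add f p (2 * p + q)).symm.trans
      ((congrArg (fun k => ∑ i ∈ Finset.range k, f i) (add_comm p (2 * p + q))).trans
        (Finset.sum_range_add f (2 * p + q) p))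
    rw [← Finset.sum_congr rfl fun i _ => congrArg f (add_comm i p),
      ← Finset.sum_congr rfl fun i _ => congrArg f (add_comm i (2 * p + q))] at e
    linarith
  have hrise : ∀ i, f (i + (2 * p + q)) - f i
      ≤ f (i + p) * f (i + p + p + q) + f (i + (p + q)) * f (i + (p + q) + p) := by
    intro i
    have e := hf i
    rw [add_assoc i p q] at e
    rw [show i + p + p + q = i + (2 * p + q) by ring,
      show i + (p + q) + p = i + (2 * p + q) by ring]
    rcases hbit i with h | h <;> rcases hbit (i + p) with h' | h' <;>
      rcases hbit (i + (p + q)) with h'' | h'' <;>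
      rcases hbit (i + (2 * p + q)) with h''' | h''' <;> simp only [h, h', h'', h'''] at e ⊢ <;>
      omega
  have hexcess : ∀ i, f i * f (i + p + q) + f i * f (i + p)
      ≤ f i + f (i + p) + f (i + p + q) - 1 := by
    intro i
    have e := hf i
    rcases hbit i with h | h <;> rw [h] at e ⊢ <;> linarith
  have hsub1 : ∑ i ∈ Finset.range p, f (i + p) * f (i + p + p + q)
      ≤ ∑ i ∈ Finset.range (2 * p + q), f i * f (i + p + q) := by
    rw [show 2 * p + q = p + p + q by ring, Finset.sum_range_add, Finset.sum_range_add]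
    have e1 : 0 ≤ ∑ i ∈ Finset.range p, f i * f (i + p + q) :=
      Finset.sum_nonneg fun i _ => mul_nonneg (h0 _) (h0 _)
    have e2 : 0 ≤ ∑ i ∈ Finset.range q, f (p + p + i) * f (p + p + i + p + q) :=
      Finset.sum_nonneg fun i _ => mul_nonneg (h0 _) (h0 _)
    simp only [add_comm p] at e1 e2 ⊢
    linarith
  have hsub2 : ∑ i ∈ Finset.range p, f (i + (p + q)) * f (i + (p + q) + p)
      ≤ ∑ i ∈ Finset.range (2 * p + q), f i * f (i + p) := by
    rw [show 2 * p + q = (p + q) + p by ring, Finset.sum_range_add]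
    have e1 : 0 ≤ ∑ i ∈ Finset.range (p + q), f i * f (i + p) :=
      Finset.sum_nonneg fun i _ => mul_nonneg (h0 _) (h0 _)
    simp only [add_comm (p + q)] at e1 ⊢
    linarith
  have s1 := Finset.sum_le_sum fun i (_ : i ∈ Finset.range p) => hrise i
  have s2 := Finset.sum_le_sum fun i (_ : i ∈ Finset.range (2 * p + q)) => hexcess i
  simp only [Finset.sum_add_distrib, Finset.sum_sub_distrib, Finset.sum_const, Finset.card_range,
    nsmul_eq_mul, mul_one] at s1 s2
  linarith

theorem sum_Icc_add_le (g : ℤ → ℤ) (M : ℤ) (h0 : ∀ t, 0 ≤ g t) (hM : ∀ t, g t ≤ M) (n i : ℕ) :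
    ∑ t ∈ Finset.Icc (-(n : ℤ)) n, g (t + i) ≤ ∑ t ∈ Finset.Icc (-(n : ℤ)) n, g t + i * M := by
  calc ∑ t ∈ Finset.Icc (-(n : ℤ)) n, g (t + i)
      = ∑ t ∈ (Finset.Icc (-(n : ℤ)) n).image (· + (i : ℤ)), g t :=
        (Finset.sum_image fun x _ y _ h => add_right_cancel h).symm
    _ ≤ ∑ t ∈ Finset.Icc (-(n : ℤ)) n ∪ Finset.Ioc (n : ℤ) (n + i), g t := by
        refine Finset.sum_le_sum_of_subset_of_nonneg ?_ fun t _ _ => h0 t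
        intro t ht
        simp only [Finset.mem_image, Finset.mem_Icc, Finset.mem_union, Finset.mem_Ioc] at ht ⊢
        omega
    _ ≤ ∑ t ∈ Finset.Icc (-(n : ℤ)) n, g t + ∑ t ∈ Finset.Ioc (n : ℤ) (n + i), g t := by
        rw [← Finset.sum_union_inter]
        exact le_add_of_nonneg_right (Finset.sum_nonneg fun t _ => h0 t)
    _ ≤ ∑ t ∈ Finset.Icc (-(n : ℤ)) n, g t + i * M := by
        gcongr
        simpa using Finset.sum_le_card_nsmul (Finset.Ioc (n : ℤ) (n + i)) g M fun t _ => hM t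

/-- A `0`-`1` function on `ℤ` hitting every translate of `{0, p, p + q}`, where
`2p + q = 3m - 1`, has average at least `m / (2p + q)`, up to a bounded boundary term. -/
theorem sum_Icc_ge_of_blocking (p q : ℕ) (m : ℤ) (hm : 3 * m = 2 * p + q + 1) (b : ℤ → ℤ)
    (h0 : ∀ t, 0 ≤ b t) (h1 : ∀ t, b t ≤ 1)
    (hb : ∀ t, 1 ≤ b t + b (t + p) + b (t + p + q)) (n : ℕ) :
    (2 * n + 1) * m - 2 * (2 * p + q) ^ 2
      ≤ (2 * p + q) * ∑ t ∈ Finset.Icc (-(n : ℤ)) n, b t := by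
  set D : ℤ → ℤ := fun t => ∑ i ∈ Finset.range (2 * p + q), b (t + i) - m with hD
  have hpair : ∀ t, -1 ≤ 2 * D t + D (t + (p + q : ℕ)) := by
    intro t
    have key := two_mul_window_add_shifted_window_ge p q (fun i => b (t + i)) (fun _ => h0 _)
      (fun _ => h1 _) fun i => by
        have := hb (t + i)
        push_cast
        simpa only [add_assoc] using this
    have e : ∑ i ∈ Finset.range (2 * p + q), b (t + (p + q : ℕ) + i)
        = ∑ i ∈ Finset.range (2 * p + q), b (t + (i + p + q : ℕ)) :=
      Finset.sum_congr rfl fun i _ => by congr 1; push_cast; ring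
    simp only [hD, e]
    push_cast at key ⊢
    linarith
  have hDle : ∀ t, D t ≤ 2 * p + q := by
    intro t
    have := Finset.sum_le_card_nsmul (Finset.range (2 * p + q)) (fun i => b (t + (i : ℕ))) 1
      fun i _ => h1 _
    simp only [Finset.card_range, nsmul_eq_mul, mul_one] at this
    push_cast at this
    simp only [hD]
    omega
  have hneg : ∀ t, -D t ≤ max (D (t + (p + q : ℕ))) 0 - max (D t) 0 := by
    intro t
    have := hpair t
    rcases le_total (D t) 0 with h | h <;>
      rcases le_total (D (t + (p + q : ℕ))) 0 with h' | h' <;> simp only [h, h', max_eq_left,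
        max_eq_right] <;> omega
  have hsum := Finset.sum_le_sum fun t (_ : t ∈ Finset.Icc (-(n : ℤ)) n) => hneg t
  have hmax := sum_Icc_add_le (fun t => max (D t) 0) (2 * p + q) (fun t => le_max_right _ _)
    (fun t => max_le (hDle t) (by positivity)) n (p + q)
  have hwin : ∑ t ∈ Finset.Icc (-(n : ℤ)) n, ∑ i ∈ Finset.range (2 * p + q), b (t + i)
      ≤ (2 * p + q) * ∑ t ∈ Finset.Icc (-(n : ℤ)) n, b t + (2 * p + q) * (2 * p + q) := by
    rw [Finset.sum_comm]
    have := Finset.sum_le_card_nsmul (Finset.range (2 * p + q))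
      (fun i => ∑ t ∈ Finset.Icc (-(n : ℤ)) n, b (t + (i : ℕ)))
      (∑ t ∈ Finset.Icc (-(n : ℤ)) n, b t + (2 * p + q : ℕ)) fun i hi => by
        have e := sum_Icc_add_le b 1 h0 h1 n i
        have := Finset.mem_range.1 hi
        have : (i : ℤ) ≤ (2 * p + q : ℕ) := by exact_mod_cast this.le
        linarith
    simp only [Finset.card_range, nsmul_eq_mul] at this
    push_cast at this
    linarith
  have hDsum : ∑ t ∈ Finset.Icc (-(n : ℤ)) n, D t
      = ∑ t ∈ Finset.Icc (-(n : ℤ)) n, ∑ i ∈ Finset.range (2 * p + q), b (t + i)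
        - (2 * n + 1) * m := by
    simp only [hD, Finset.sum_sub_distrib, Finset.sum_const, Int.card_Icc, nsmul_eq_mul]
    congr 2
    omega
  rw [Finset.sum_sub_distrib, Finset.sum_neg_distrib] at hsum
  push_cast at hsum hmax
  nlinarith [mul_nonneg (Int.natCast_nonneg p) (show (0 : ℤ) ≤ 2 * p + q by positivity)]

/-- A counting bound `|A ∩ [-n, n]| ≤ c (2n + 1) + C` bounds the upper density by `c`. -/
theorem upperDensity_le_of_ncard_le (A : Set ℤ) (c C : ℝ)
    (h : ∀ n : ℕ, ((A ∩ Icc (-(n : ℤ)) n).ncard : ℝ) ≤ c * (2 * n + 1) + C) :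
    upperDensity A ≤ c := by
  have hlim : Tendsto (fun n : ℕ => c + C / (2 * (n : ℝ) + 1)) atTop (nhds c) := by
    have : Tendsto (fun n : ℕ => 2 * (n : ℝ) + 1) atTop atTop :=
      tendsto_atTop_add_const_right _ _
        (tendsto_natCast_atTop_atTop.const_mul_atTop (by norm_num))
    simpa using tendsto_const_nhds.add (this.const_div_atTop C)
  rw [← hlim.limsup_eq]
  refine limsup_le_limsup (Eventually.of_forall fun n => ?_) ?_ hlim.isBoundedUnder_le
  · have hn : (0 : ℝ) < 2 * n + 1 := by positivity
    simp only
    rw [div_le_iff₀ hn, add_mul, div_mul_cancel₀ _ hn.ne']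
    exact h n
  · exact isCoboundedUnder_le_of_le atTop (x := 0) fun n => by positivity

theorem SFree.upperDensity_le {p q : ℕ} {m : ℤ} (hp : 0 < p) (hm : 3 * m = 2 * p + q + 1)
    {A : Set ℤ} (hA : SFree ({0, (p : ℤ), (p : ℤ) + q} : Set ℤ) A) :
    upperDensity A ≤ ((2 * p + q : ℝ) - m) / (2 * p + q) := by
  classical
  have hN : (0 : ℝ) < 2 * p + q := by positivity
  refine upperDensity_le_of_ncard_le A _ (2 * (2 * p + q)) fun n => ?_
  have key := sum_Icc_ge_of_blocking p q m hm (fun t => if t ∈ A then 0 else 1)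
    (fun t => by split_ifs <;> norm_num)
    (fun t => by split_ifs <;> norm_num) (fun t => by
      have h : ¬ (t ∈ A ∧ t + p ∈ A ∧ t + p + q ∈ A) := by
        rintro ⟨h1, h2, h3⟩
        refine hA t ?_
        rintro _ ⟨x, rfl | rfl | rfl, rfl⟩
        · simpa using h1
        · simpa [add_comm] using h2
        · simpa [add_comm, add_left_comm, add_assoc] using h3
      split_ifs <;> simp_all) n
  have hcount : ((A ∩ Icc (-(n : ℤ)) n).ncard : ℤ)
      + ∑ t ∈ Finset.Icc (-(n : ℤ)) n, (if t ∈ A then (0 : ℤ) else 1) = 2 * n + 1 := by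
    have e : A ∩ Icc (-(n : ℤ)) n = ((Finset.Icc (-(n : ℤ)) n).filter (· ∈ A) : Finset ℤ) := by
      ext t
      simp only [mem_inter_iff, mem_Icc, Finset.coe_filter, Finset.mem_Icc, mem_ofPred_eq]
      tauto
    rw [e, ncard_coe_finset, Finset.card_filter]
    push_cast
    rw [← Finset.sum_add_distrib, Finset.sum_congr rfl (g := fun _ => (1 : ℤ))
      fun t _ => by split_ifs <;> rfl]
    simp only [Finset.sum_const, Int.card_Icc, nsmul_eq_mul, mul_one]
    omega
  have key' : ((2 * n + 1) * m - 2 * (2 * p + q) ^ 2 : ℝ)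
      ≤ (2 * p + q) * (2 * n + 1 - ((A ∩ Icc (-(n : ℤ)) n).ncard : ℝ)) := by
    rw [eq_sub_of_add_eq' hcount] at key
    exact_mod_cast key
  rw [div_mul_eq_mul_div, ← sub_le_iff_le_add, le_div_iff₀ hN]
  linarith

theorem stmt8 (l1 l2 : ℤ) (h1 : 0 < l1) (h2 : 0 < l2) (hco : Int.gcd l1 l2 = 1)
    (hmod : l1 % 3 = (l2 + 1) % 3) :
    (∀ A : Set ℤ, SFree ({0, l1, l1 + l2} : Set ℤ) A →
      upperDensity A ≤ (⌊(2 : ℝ) / 3 * (2 * l1 + l2)⌋ : ℝ) / (2 * l1 + l2)) ∧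
    dF ({0, l1, l1 + l2} : Set ℤ) ≤ (⌊(2 : ℝ) / 3 * (2 * l1 + l2)⌋ : ℝ) / (2 * l1 + l2) := by
  have hfloor : ∃ m : ℤ, 3 * m = 2 * l1 + l2 + 1 := ⟨(2 * l1 + l2 + 1) / 3, by omega⟩
  obtain ⟨m, hm⟩ := hfloor
  lift l1 to ℕ using h1.le
  lift l2 to ℕ using h2.le
  have hmR : (3 * m : ℝ) = 2 * l1 + l2 + 1 := by exact_mod_cast hm
  have hval : ⌊(2 : ℝ) / 3 * (2 * (l1 : ℤ) + (l2 : ℤ))⌋ = 2 * (l1 : ℤ) + l2 - m := by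
    rw [Int.floor_eq_iff]
    push_cast
    constructor <;> linarith
  have hbound : ∀ A : Set ℤ, SFree ({0, (l1 : ℤ), (l1 : ℤ) + l2} : Set ℤ) A →
      upperDensity A ≤ (⌊(2 : ℝ) / 3 * (2 * (l1 : ℤ) + (l2 : ℤ))⌋ : ℝ)
        / (2 * (l1 : ℤ) + (l2 : ℤ)) := by
    intro A hA
    rw [hval]
    push_cast
    exact hA.upperDensity_le (by exact_mod_cast h1) hm
  refine ⟨hbound, csSup_le (Nonempty.image _ ⟨∅, fun t h => ?_⟩) ?_⟩
  · exact h (mem_image_of_mem (· + t) (mem_insert 0 _))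
  · rintro _ ⟨A, hA, rfl⟩
    exact hbound A hA
end

section
/- Let λ₁, λ₂ be coprime positive integers and S = {0, λ₁, λ₁+λ₂}. Then the minimum covering density satisfies d_c(S) = min( ⌈(1/3)(λ₁+2λ₂)⌉/(λ₁+2λ₂), ⌈(1/3)(2λ₁+λ₂)⌉/(2λ₁+λ₂) ). -/
open Filter Set

/-- A discrete antiderivative of `g`, normalised to vanish at `0`. -/
noncomputable def discretePrimitive (g : ℤ → ℤ) (y : ℤ) : ℤ :=
  ∑ i ∈ Finset.Ico 0 y, g i - ∑ i ∈ Finset.Ico y 0, g i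

lemma discretePrimitive_add_one (g : ℤ → ℤ) (y : ℤ) :
    discretePrimitive g (y + 1) = discretePrimitive g y + g y := by
  unfold discretePrimitive
  rcases le_or_gt 0 y with hy | hy
  · rw [← Finset.insert_Ico_right_eq_Ico_add_one hy, Finset.sum_insert (by simp),
      Finset.Ico_eq_empty (by omega : ¬ y < 0), Finset.Ico_eq_empty (by omega : ¬ y + 1 < 0)]
    simp [add_comm]
  · rw [← Finset.insert_Ico_add_one_left_eq_Ico hy, Finset.sum_insert (by simp),
      Finset.Ico_eq_empty (by omega : ¬ 0 < y), Finset.Ico_eq_empty (by omega : ¬ 0 < y + 1)]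
    simp

lemma eq_of_forall_add_one_eq {G : ℤ → ℤ} (h : ∀ y, G (y + 1) = G y) (x y : ℤ) : G x = G y := by
  have key : ∀ z, G z = G 0 := fun z => by
    induction z using Int.induction_on with
    | zero => rfl
    | succ i ih => rw [h, ih]
    | pred i ih => rw [← ih, ← h (-(i : ℤ) - 1), sub_add_cancel]
  rw [key x, key y]

lemma discretePrimitive_mono {g : ℤ → ℤ} (hg : ∀ y, 0 ≤ g y) : Monotone (discretePrimitive g) :=
  monotone_int_of_le_succ fun y => by rw [discretePrimitive_add_one]; linarith [hg y]

lemma sum_Icc_neg_self_eq_sub (g : ℤ → ℤ) (N : ℕ) :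
    ∑ y ∈ Finset.Icc (-N : ℤ) N, g y = discretePrimitive g (N + 1) - discretePrimitive g (-N) := by
  have key : ∀ m : ℕ, ∑ y ∈ Finset.Ico (-N : ℤ) (-N + m), g y =
      discretePrimitive g (-N + m) - discretePrimitive g (-N) := fun m => by
    induction m with
    | zero => simp
    | succ m ih =>
      push_cast
      rw [← add_assoc, ← Finset.insert_Ico_right_eq_Ico_add_one (by omega),
        Finset.sum_insert (by simp), ih, discretePrimitive_add_one]
      ring
  have h := key (2 * N + 1)
  have e : (-N : ℤ) + ((2 * N + 1 : ℕ) : ℤ) = N + 1 := by push_cast; ring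
  rw [e] at h
  rw [← h]
  congr 1

/-- `F` has bounded sums over the symmetric intervals `[-N, N]`. -/
def HasBoundedSums (F : ℤ → ℤ) : Prop :=
  ∃ C : ℤ, ∀ N : ℕ, |∑ y ∈ Finset.Icc (-N : ℤ) N, F y| ≤ C

namespace HasBoundedSums

lemma add {F G : ℤ → ℤ} (hF : HasBoundedSums F) (hG : HasBoundedSums G) :
    HasBoundedSums fun y => F y + G y := by
  obtain ⟨C, hC⟩ := hF
  obtain ⟨D, hD⟩ := hG
  refine ⟨C + D, fun N => ?_⟩
  rw [Finset.sum_add_distrib]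
  exact (abs_add_le _ _).trans (add_le_add (hC N) (hD N))

lemma const_mul {F : ℤ → ℤ} (hF : HasBoundedSums F) (k : ℤ) :
    HasBoundedSums fun y => k * F y := by
  obtain ⟨C, hC⟩ := hF
  refine ⟨|k| * C, fun N => ?_⟩
  rw [← Finset.mul_sum, abs_mul]
  exact mul_le_mul_of_nonneg_left (hC N) (abs_nonneg k)

lemma shift_sub {g : ℤ → ℤ} (hg : ∀ y, |g y| ≤ 1) (s : ℤ) :
    HasBoundedSums fun y => g (y + s) - g y := by
  have key : ∀ x, |discretePrimitive g (x + s) - discretePrimitive g x| ≤ |s| := fun x => by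
    induction s using Int.induction_on with
    | zero => simp
    | succ i ih =>
      rw [← add_assoc, discretePrimitive_add_one]
      have := hg (x + i)
      rw [abs_le] at this ih ⊢
      rw [abs_of_nonneg (by positivity)] at ih ⊢
      constructor <;> linarith
    | pred i ih =>
      have e := discretePrimitive_add_one g (x + (-(i : ℤ) - 1))
      rw [show x + (-(i : ℤ) - 1) + 1 = x + -i by ring] at e
      have := hg (x + (-(i : ℤ) - 1))
      rw [abs_le] at this ih ⊢
      rw [abs_neg, abs_of_nonneg (by positivity)] at ih
      rw [abs_of_neg (by omega)]
      constructor <;> linarith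
  refine ⟨2 * |s|, fun N => ?_⟩
  have hs : ∀ x, discretePrimitive (fun y => g (y + s)) x - discretePrimitive g (x + s) =
      0 - discretePrimitive g s := fun x => by
    have := eq_of_forall_add_one_eq
      (G := fun x => discretePrimitive (fun y => g (y + s)) x - discretePrimitive g (x + s))
      (fun y => by
        simp only [discretePrimitive_add_one]
        rw [show y + 1 + s = y + s + 1 by ring, discretePrimitive_add_one]
        ring) x 0
    simpa [discretePrimitive] using this
  rw [Finset.sum_sub_distrib, sum_Icc_neg_self_eq_sub, sum_Icc_neg_self_eq_sub]
  have h1 := hs (N + 1)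
  have h2 := hs (-N)
  have k1 := key (N + 1)
  have k2 := key (-N)
  rw [abs_le] at k1 k2 ⊢
  constructor <;> linarith

lemma window {g : ℤ → ℤ} (hg : ∀ y, |g y| ≤ 1) (s : ℤ) :
    HasBoundedSums fun y => discretePrimitive g (y + s) - discretePrimitive g y - s * g y := by
  induction s using Int.induction_on with
  | zero => exact ⟨0, fun N => by simp⟩
  | succ i ih =>
    convert ih.add (shift_sub hg i) using 2 with y
    rw [← add_assoc, discretePrimitive_add_one]
    ring
  | pred i ih =>
    convert ih.add ((shift_sub hg (-(i : ℤ) - 1)).const_mul (-1)) using 2 with y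
    rw [show y + -(i : ℤ) = y + (-(i : ℤ) - 1) + 1 by ring, discretePrimitive_add_one]
    ring

end HasBoundedSums

/-- If the indicator function `f` meets every translate of `{0, a, a + b}` and
`a + 2 * b = 3 * p - 1`, then the averages of `f` are asymptotically at least `p / (a + 2 * b)`.
The integer-valued function `H` below counts, up to a constant, the translates of
`{0, b, a + b}` on which `f` is constant minus those of `{0, a, a + b}` on which `f` is `1`;
its integrality improves the trivial bound `1 / 3`. -/
lemma mul_sum_indicator_ge_of_blocking {a b p : ℤ} (ha : 0 ≤ a) (hb : 0 ≤ b)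
    (hp : 3 * p = a + 2 * b + 1) {f : ℤ → ℤ} (hf : ∀ y, f y = 0 ∨ f y = 1)
    (hcov : ∀ y, 1 ≤ f y + f (y + a) + f (y + a + b)) :
    ∃ C : ℤ, ∀ N : ℕ,
      p * (2 * N + 1) - C ≤ (a + 2 * b) * ∑ y ∈ Finset.Icc (-N : ℤ) N, f y := by
  set u : ℤ → ℤ := fun y => f y * f (y + a) with hu
  set v : ℤ → ℤ := fun y => f y * f (y + b) with hv
  set l : ℤ → ℤ := fun y => f y * f (y + a + b) * (1 - f (y + a)) with hl
  set q : ℤ → ℤ := fun y => f y * f (y + a) * f (y + a + b) with hq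
  set e : ℤ → ℤ := fun y => (1 - f y) * (1 - f (y + b)) * (1 - f (y + a + b)) +
    f y * f (y + b) * f (y + a + b) with he
  have bu : ∀ y, 0 ≤ u y ∧ u y ≤ 1 := fun y => by
    rcases hf y with h | h <;> rcases hf (y + a) with h' | h' <;> simp [hu, h, h']
  have bv : ∀ y, 0 ≤ v y ∧ v y ≤ 1 := fun y => by
    rcases hf y with h | h <;> rcases hf (y + b) with h' | h' <;> simp [hv, h, h']
  have bl : ∀ y, 0 ≤ l y ∧ l y ≤ 1 := fun y => by
    rcases hf y with h | h <;> rcases hf (y + a) with h' | h' <;>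
      rcases hf (y + a + b) with h'' | h'' <;> simp [hl, h, h', h'']
  have bq : ∀ y, 0 ≤ q y ∧ q y ≤ u y ∧ q y ≤ v (y + a) := fun y => by
    rcases hf y with h | h <;> rcases hf (y + a) with h' | h' <;>
      rcases hf (y + a + b) with h'' | h'' <;> simp [hq, hu, hv, h, h', h'']
  have be : ∀ y, 0 ≤ e y := fun y => by
    rcases hf y with h | h <;> rcases hf (y + b) with h' | h' <;>
      rcases hf (y + a + b) with h'' | h'' <;> simp [he, h, h', h'']
  have up : ∀ y, f y + f (y + a) + f (y + a + b) - 1 = u y + v (y + a) + l y := fun y => by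
    have := hcov y
    rcases hf y with h | h <;> rcases hf (y + a) with h' | h' <;>
      rcases hf (y + a + b) with h'' | h'' <;> simp [hl, hu, hv, h, h', h''] at this ⊢
  have down : ∀ y, f y + f (y + b) + f (y + a + b) - 1 =
      v y + u (y + b) + l y + q y - e y := fun y => by
    simp only [hu, hv, hl, hq, he]
    rw [show y + b + a = y + a + b by ring]
    ring
  have P := discretePrimitive_add_one
  have E1 := eq_of_forall_add_one_eq (G := fun y => discretePrimitive f y +
      discretePrimitive f (y + a) + discretePrimitive f (y + a + b) - y - discretePrimitive u y -
      discretePrimitive v (y + a) - discretePrimitive l y) fun y => by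
    rw [show y + 1 + a = y + a + 1 by ring, show y + a + 1 + b = y + a + b + 1 by ring]
    simp only [P]
    linarith [up y]
  have E2 := eq_of_forall_add_one_eq (G := fun y => discretePrimitive f y +
      discretePrimitive f (y + b) + discretePrimitive f (y + a + b) - y - discretePrimitive v y -
      discretePrimitive u (y + b) - discretePrimitive l y - discretePrimitive q y +
      discretePrimitive e y) fun y => by
    rw [show y + 1 + a + b = y + a + b + 1 by ring, show y + 1 + b = y + b + 1 by ring]
    simp only [P]
    linarith [down y]
  have mu := discretePrimitive_mono fun y => (bu y).1
  have mv := discretePrimitive_mono fun y => (bv y).1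
  have ml := discretePrimitive_mono fun y => (bl y).1
  have mq := discretePrimitive_mono fun y => (bq y).1
  have me := discretePrimitive_mono be
  have muq : Monotone fun y => discretePrimitive u y - discretePrimitive q y :=
    monotone_int_of_le_succ fun y => by simp only [P]; linarith [(bq y).2.1]
  set H : ℤ → ℤ := fun y => discretePrimitive f (y + a) - discretePrimitive f (y + b) -
    (discretePrimitive v (y + a) - discretePrimitive v y) +
    (discretePrimitive u (y + b) - discretePrimitive u y) with hH
  set R : ℤ → ℤ := fun y => discretePrimitive v (y + a) - discretePrimitive v (y + -(a + b)) +
    (discretePrimitive l y - discretePrimitive l (y + -b)) +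
    (discretePrimitive q y - discretePrimitive q (y + -b)) with hR
  have R_nonneg : ∀ y, 0 ≤ R y := fun y => by
    have h1 := mv (show y + -(a + b) ≤ y + a by omega)
    have h2 := ml (show y + -b ≤ y by omega)
    have h3 := mq (show y + -b ≤ y by omega)
    simp only [hR]
    linarith
  have flux : ∀ y, 0 ≤ 3 * H y - (a - b) + R y := fun y => by
    have c1 := E1 y (y + -a)
    have c2 := E1 y (y + -(a + b))
    have d1 := E2 y (y + -b)
    have d2 := E2 y (y + -(a + b))
    rw [show y + -a + a = y by ring] at c1
    rw [show y + -(a + b) + a = y + -b by ring, show y + -b + b = y by ring] at c2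
    rw [show y + -b + b = y by ring, show y + -b + a + b = y + a by ring] at d1
    rw [show y + -(a + b) + a + b = y by ring, show y + -(a + b) + b = y + -a by ring] at d2
    have h1 := mu (show y ≤ y + b by omega)
    have h2 := muq (show y + -(a + b) ≤ y by omega)
    have h3 := ml (show y + -a ≤ y by omega)
    have h4 := me (show y + -b ≤ y by omega)
    have h5 := me (show y + -(a + b) ≤ y by omega)
    simp only [hR, hH]
    linarith
  have main : ∀ y, 0 ≤ 2 * H y - 2 * (p - b) + R y := fun y => by
    have := flux y
    have := R_nonneg y
    omega
  have wf : ∀ y, |f y| ≤ 1 := fun y => by rcases hf y with h | h <;> simp [h]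
  have wu : ∀ y, |u y| ≤ 1 := fun y => abs_le.2 ⟨by linarith [(bu y).1], (bu y).2⟩
  have wv : ∀ y, |v y| ≤ 1 := fun y => abs_le.2 ⟨by linarith [(bv y).1], (bv y).2⟩
  have wl : ∀ y, |l y| ≤ 1 := fun y => abs_le.2 ⟨by linarith [(bl y).1], (bl y).2⟩
  have wq : ∀ y, |q y| ≤ 1 := fun y =>
    abs_le.2 ⟨by linarith [(bq y).1], (bq y).2.1.trans (bu y).2⟩
  obtain ⟨C, hC⟩ := (((((((((((HasBoundedSums.window wf a).const_mul (-2)).add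
    ((HasBoundedSums.window wf b).const_mul 2)).add
    ((HasBoundedSums.window wv a).const_mul 1)).add
    ((HasBoundedSums.window wu b).const_mul (-2))).add
    ((HasBoundedSums.window wv (-(a + b))).const_mul 1)).add
    ((HasBoundedSums.window wl (-b)).const_mul 1)).add
    ((HasBoundedSums.window wq (-b)).const_mul 1)).add
    ((HasBoundedSums.shift_sub wv a).const_mul b)).add
    ((HasBoundedSums.shift_sub wf a).const_mul (-2 * b))).add
    ((HasBoundedSums.shift_sub wf (a + b)).const_mul (-2 * b)))
  refine ⟨C, fun N => ?_⟩
  have hN := neg_le_of_abs_le (hC N)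
  have hle := hN.trans <| Finset.sum_le_sum (s := Finset.Icc (-N : ℤ) N)
    (g := fun y => 2 * ((a + 2 * b) * f y - p)) fun y _ => by
      have h1 := main y
      have h2 := mul_nonneg hb (sub_nonneg.2 (bq y).2.2)
      have h3 := mul_nonneg hb (bl y).1
      have h4 := congrArg (b * ·) (up y)
      simp only [hH, hR] at h1 h4
      simp only [← add_assoc] at h1 ⊢
      linarith
  rw [← Finset.mul_sum, Finset.sum_sub_distrib, ← Finset.mul_sum, Finset.sum_const,
    Int.card_Icc, nsmul_eq_mul, Int.toNat_of_nonneg (by omega)] at hle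
  have hC0 := (abs_nonneg _).trans (hC N)
  linarith

lemma ncard_inter_Icc_eq_sum (A : Set ℤ) [DecidablePred (· ∈ A)] (N : ℕ) :
    ((A ∩ Icc (-(N : ℤ)) N).ncard : ℤ) =
      ∑ y ∈ Finset.Icc (-N : ℤ) N, if y ∈ A then 1 else 0 := by
  rw [← Finset.natCast_card_filter, ← Set.ncard_coe_finset]
  congr 2
  ext x
  simp only [mem_inter_iff, mem_Icc, Finset.coe_filter, Finset.mem_Icc, mem_ofPred_eq]
  tauto

lemma ncard_inter_Icc_le (A : Set ℤ) (N : ℕ) :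
    ((A ∩ Icc (-(N : ℤ)) N).ncard : ℤ) ≤ 2 * N + 1 := by
  classical
  rw [ncard_inter_Icc_eq_sum]
  refine (Finset.sum_le_sum fun y _ => (show (if y ∈ A then 1 else 0 : ℤ) ≤ 1 by
    split_ifs <;> simp)).trans ?_
  rw [Finset.sum_const, Int.card_Icc, nsmul_eq_mul, Int.toNat_of_nonneg (by omega)]
  linarith

lemma tendsto_add_div_two_mul_add_one (x c : ℝ) :
    Tendsto (fun n : ℕ => x + c / (2 * n + 1)) atTop (nhds x) := by
  have h : Tendsto (fun n : ℕ => (2 * n + 1 : ℝ)) atTop atTop :=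
    tendsto_atTop_add_const_right _ _
      (tendsto_natCast_atTop_atTop.const_mul_atTop two_pos)
  simpa using (h.const_div_atTop c).const_add x

lemma div_le_lowerDensity {A : Set ℤ} {p q C : ℤ} (hq : 0 < q)
    (h : ∀ N : ℕ, p * (2 * N + 1) - C ≤ q * ((A ∩ Icc (-(N : ℤ)) N).ncard : ℤ)) :
    (p / q : ℝ) ≤ lowerDensity A := by
  have hq' : (0 : ℝ) < q := by exact_mod_cast hq
  have ht := tendsto_add_div_two_mul_add_one (p / q) (-C / q)
  rw [← ht.liminf_eq]
  refine liminf_le_liminf (Eventually.of_forall fun N => ?_) ht.isBoundedUnder_ge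
    (IsBoundedUnder.isCoboundedUnder_ge (isBoundedUnder_of ⟨1, fun N => ?_⟩))
  · have hN : (p : ℝ) * (2 * N + 1) - C ≤ q * (A ∩ Icc (-(N : ℤ)) N).ncard := by
      exact_mod_cast h N
    rw [le_div_iff₀ (by positivity), add_mul, div_mul_cancel₀ _ (by positivity),
      div_mul_eq_mul_div, ← add_div, div_le_iff₀ hq']
    linarith
  · have hN : ((A ∩ Icc (-(N : ℤ)) N).ncard : ℝ) ≤ 2 * N + 1 := by
      exact_mod_cast ncard_inter_Icc_le A N
    exact div_le_one_of_le₀ hN (by positivity)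

lemma lowerDensity_nonneg (A : Set ℤ) : 0 ≤ lowerDensity A := by
  simpa using div_le_lowerDensity (A := A) (p := 0) (q := 1) (C := 0) one_pos fun N => by simp

lemma lowerDensity_le_div {A : Set ℤ} {p q C : ℤ} (hq : 0 < q)
    (h : ∀ N : ℕ, q * ((A ∩ Icc (-(N : ℤ)) N).ncard : ℤ) ≤ p * (2 * N + 1) + C) :
    lowerDensity A ≤ (p / q : ℝ) := by
  have hq' : (0 : ℝ) < q := by exact_mod_cast hq
  have ht := tendsto_add_div_two_mul_add_one (p / q) (C / q)
  rw [← ht.liminf_eq]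
  refine liminf_le_liminf (Eventually.of_forall fun N => ?_)
    (isBoundedUnder_of ⟨0, fun N => ?_⟩) ht.isCoboundedUnder_ge
  · have hN : (q : ℝ) * (A ∩ Icc (-(N : ℤ)) N).ncard ≤ p * (2 * N + 1) + C := by
      exact_mod_cast h N
    rw [div_le_iff₀ (by positivity), add_mul, div_mul_cancel₀ _ (by positivity),
      div_mul_eq_mul_div, ← add_div, le_div_iff₀ hq']
    linarith
  · positivity

lemma mem_translateSet_triple {l1 l2 t a : ℤ} :
    t ∈ translateSet {0, l1, l1 + l2} a ↔ a = t ∨ a = t - l1 ∨ a = t - l1 - l2 := by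
  simp only [translateSet, mem_image, mem_insert_iff, mem_singleton_iff, exists_eq_or_imp,
    exists_eq_left]
  omega

lemma sCovering_triple_iff {l1 l2 : ℤ} {A : Set ℤ} :
    SCovering {0, l1, l1 + l2} A ↔ ∀ t, t ∈ A ∨ t - l1 ∈ A ∨ t - l1 - l2 ∈ A := by
  simp only [SCovering, mem_translateSet_triple]
  refine forall_congr' fun t => ⟨?_, ?_⟩
  · rintro ⟨a, ha, rfl | rfl | rfl⟩ <;> simp [ha]
  · rintro (h | h | h)
    exacts [⟨_, h, .inl rfl⟩, ⟨_, h, .inr (.inl rfl)⟩, ⟨_, h, .inr (.inr rfl)⟩]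

/-- The lower density of an `S`-covering set is at least the smaller of the two ratios
`⌈n / 3⌉ / n` with `n = l1 + 2 * l2` and `n = 2 * l1 + l2`. -/
lemma le_lowerDensity_of_sCovering {l1 l2 p q : ℤ} (h1 : 0 < l1) (h2 : 0 < l2)
    (hp : l1 + 2 * l2 ≤ 3 * p ∧ 3 * p < l1 + 2 * l2 + 3)
    (hq : 2 * l1 + l2 ≤ 3 * q ∧ 3 * q < 2 * l1 + l2 + 3) {A : Set ℤ}
    (hA : SCovering {0, l1, l1 + l2} A) :
    min (p / (l1 + 2 * l2) : ℝ) (q / (2 * l1 + l2)) ≤ lowerDensity A := by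
  classical
  rw [sCovering_triple_iff] at hA
  set f : ℤ → ℤ := fun y => if y ∈ A then 1 else 0 with hf
  have hf01 : ∀ y, f y = 0 ∨ f y = 1 := fun y => by by_cases h : y ∈ A <;> simp [hf, h]
  have hcov : ∀ t, 1 ≤ f t + f (t - l1) + f (t - l1 - l2) := fun t => by
    have k0 := hf01 t
    have k1 := hf01 (t - l1)
    have k2 := hf01 (t - l1 - l2)
    have : f t = 1 ∨ f (t - l1) = 1 ∨ f (t - l1 - l2) = 1 := by
      simpa [hf] using hA t
    omega
  have hsum := fun N : ℕ => ncard_inter_Icc_eq_sum A N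
  rcases (by omega : 3 * p = l1 + 2 * l2 + 1 ∨ 3 * q = 2 * l1 + l2 + 1 ∨ 3 * p = l1 + 2 * l2)
    with h | h | h
  · refine (min_le_left _ _).trans ?_
    obtain ⟨C, hC⟩ := mul_sum_indicator_ge_of_blocking h1.le h2.le h (f := fun y => f (-y))
      (fun y => hf01 _) fun y => by
        have := hcov (-y)
        rwa [show -y - l1 = -(y + l1) by ring, show -(y + l1) - l2 = -(y + l1 + l2) by ring] at this
    have := div_le_lowerDensity (A := A) (p := p) (q := l1 + 2 * l2) (C := C) (by omega)
      fun N => by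
        rw [hsum]
        convert hC N using 2
        refine Finset.sum_nbij' (fun y => -y) (fun y => -y) ?_ ?_ ?_ ?_ ?_ <;>
          simp [hf] <;> omega
    simpa using this
  · refine (min_le_right _ _).trans ?_
    obtain ⟨C, hC⟩ := mul_sum_indicator_ge_of_blocking h2.le h1.le
      (by rw [h]; ring : 3 * q = l2 + 2 * l1 + 1) hf01 fun y => by
        have := hcov (y + l1 + l2)
        rw [show y + l1 + l2 - l1 = y + l2 by ring, show y + l2 - l2 = y by ring,
          show y + l1 + l2 = y + l2 + l1 by ring] at this
        linarith
    have := div_le_lowerDensity (A := A) (p := q) (q := 2 * l1 + l2) (C := C) (by omega)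
      fun N => by
        rw [hsum, show 2 * l1 + l2 = l2 + 2 * l1 by ring]
        exact hC N
    simpa using this
  · refine (min_le_left _ _).trans ?_
    have e : (p / (l1 + 2 * l2) : ℝ) = ((1 : ℤ) : ℝ) / ((3 : ℤ) : ℝ) := by
      have h' : (3 * p : ℝ) = l1 + 2 * l2 := by exact_mod_cast h
      have : (0 : ℝ) < l1 + 2 * l2 := by exact_mod_cast (by omega : 0 < l1 + 2 * l2)
      rw [div_eq_div_iff this.ne' (by norm_num)]
      push_cast
      linarith
    rw [e]
    have hf1 : ∀ y, |f y| ≤ 1 := fun y => by rcases hf01 y with h | h <;> simp [h]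
    obtain ⟨C, hC⟩ := (HasBoundedSums.shift_sub hf1 (-l1)).add
      (HasBoundedSums.shift_sub hf1 (-l1 + -l2))
    refine div_le_lowerDensity (C := C) three_pos fun N => ?_
    rw [hsum]
    have hN := le_of_abs_le (hC N)
    have hle : ∑ y ∈ Finset.Icc (-N : ℤ) N, (1 - 3 * f y) ≤ _ :=
      (Finset.sum_le_sum fun y _ => by
        have := hcov y
        simp only [sub_eq_add_neg, add_assoc] at this ⊢
        linarith).trans hN
    rw [Finset.sum_sub_distrib, ← Finset.mul_sum, Finset.sum_const,
      Int.card_Icc, nsmul_eq_mul, Int.toNat_of_nonneg (by omega)] at hle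
    linarith

lemma exists_periodic_mem_arithmetic_triple {n g p : ℤ} (hn : 0 < n) (hg : IsCoprime g n)
    (hp : n ≤ 3 * p) :
    ∃ A : Set ℤ, (∀ s, s ∈ A ∨ s + g ∈ A ∨ s + 2 * g ∈ A) ∧ (∀ x, x + n ∈ A ↔ x ∈ A) ∧
      lowerDensity A ≤ (p / n : ℝ) := by
  classical
  set A : Set ℤ := {x | ∃ i ∈ Finset.Ico 0 p, x ≡ 3 * i * g [ZMOD n]} with hA
  refine ⟨A, fun s => ?_, fun x => ?_, ?_⟩
  · obtain ⟨u, v, huv⟩ := hg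
    set m := (s * u) % n with hm
    have m0 : 0 ≤ m := Int.emod_nonneg _ hn.ne'
    have m1 : m < n := Int.emod_lt_of_pos _ hn
    have hs : s ≡ m * g [ZMOD n] := by
      have h1 : m * g ≡ s * u * g [ZMOD n] := (Int.mod_modEq (s * u) n).mul_right g
      refine Int.ModEq.trans ?_ h1.symm
      refine (Int.modEq_iff_dvd.2 ⟨-(s * v), ?_⟩)
      linear_combination s * huv
    have key : ∀ k, (∃ i ∈ Finset.Ico 0 p, m + k ≡ 3 * i [ZMOD n]) → s + k * g ∈ A := by
      rintro k ⟨i, hi, hik⟩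
      refine ⟨i, hi, (hs.add_right _).trans ?_⟩
      rw [← add_mul]
      exact hik.mul_right g
    have h0 := key 0
    have h1 := key 1
    have h2 := key 2
    rw [zero_mul, add_zero, add_zero] at h0
    rw [one_mul] at h1
    have wrap : ∀ k, m + k = n → ∃ i ∈ Finset.Ico 0 p, m + k ≡ 3 * i [ZMOD n] := fun k hk =>
      ⟨0, by simp; omega, by rw [hk]; simp [Int.ModEq]⟩
    have inner : ∀ k, 3 ∣ m + k → m + k < n → 0 ≤ k →
        ∃ i ∈ Finset.Ico 0 p, m + k ≡ 3 * i [ZMOD n] := by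
      rintro k ⟨i, hi⟩ hk k0
      exact ⟨i, by simp; omega, by rw [hi]⟩
    rcases (by omega : m + 1 = n ∨ m + 2 = n ∨ m + 2 < n) with h | h | h
    · exact .inr (.inl (h1 (wrap 1 h)))
    · exact .inr (.inr (h2 (wrap 2 h)))
    · rcases (by omega : (3 : ℤ) ∣ m ∨ (3 : ℤ) ∣ m + 1 ∨ (3 : ℤ) ∣ m + 2) with d | d | d
      · refine .inl (h0 ?_)
        simpa using inner 0 (by simpa using d) (by omega) le_rfl
      · exact .inr (.inl (h1 (inner 1 d (by omega) (by omega))))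
      · exact .inr (.inr (h2 (inner 2 d h (by omega))))
  · simp [hA, Int.ModEq]
  · have p0 : 0 ≤ p := by omega
    refine lowerDensity_le_div (C := p * n) hn fun N => ?_
    have hsub : A ∩ Icc (-(N : ℤ)) N ⊆ ↑((Finset.Ico 0 p).biUnion fun i =>
        (Finset.Ioc (-(N : ℤ) - 1) N).filter fun x => x ≡ 3 * i * g [ZMOD n]) := by
      rintro x ⟨⟨i, hi, hx⟩, h1, h2⟩
      simp only [Finset.coe_biUnion, mem_iUnion, Finset.mem_coe, Finset.mem_filter,
        Finset.mem_Ioc]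
      exact ⟨i, hi, ⟨by omega, h2⟩, hx⟩
    have hcard := Set.ncard_le_ncard hsub (Finset.finite_toSet _)
    rw [Set.ncard_coe_finset] at hcard
    have hclass : ∀ r : ℤ, n * (((Finset.Ioc (-(N : ℤ) - 1) N).filter
        fun x => x ≡ r [ZMOD n]).card : ℤ) ≤ 2 * N + 1 + n := fun r => by
      rw [Int.Ioc_filter_modEq_card _ _ hn]
      have hn' : (0 : ℚ) < n := by exact_mod_cast hn
      have a1 := Int.floor_le (((N : ℤ) - r : ℚ) / n)
      have a2 := Int.lt_floor_add_one (((-(N : ℤ) - 1 : ℤ) - r : ℚ) / n)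
      rw [le_div_iff₀ hn'] at a1
      rw [div_lt_iff₀ hn'] at a2
      generalize ⌊(((N : ℤ) : ℚ) - r) / n⌋ = x at a1 ⊢
      generalize ⌊((-(N : ℤ) - 1 : ℤ) - r : ℚ) / n⌋ = z at a2 ⊢
      norm_cast at a1 a2
      rw [mul_max_of_nonneg _ _ hn.le]
      refine max_le ?_ (by omega)
      linarith
    have hb := (Nat.cast_le (α := ℤ)).2 (hcard.trans Finset.card_biUnion_le)
    push_cast at hb
    refine (mul_le_mul_of_nonneg_left hb hn.le).trans ?_
    rw [Finset.mul_sum]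
    refine (Finset.sum_le_sum fun i _ => hclass _).trans ?_
    rw [Finset.sum_const, Int.card_Ico, nsmul_eq_mul, Int.toNat_of_nonneg (by omega)]
    linarith

theorem stmt10 (l1 l2 : ℤ) (h1 : 0 < l1) (h2 : 0 < l2) (hco : Int.gcd l1 l2 = 1) :
    dC ({0, l1, l1 + l2} : Set ℤ) =
      min ((⌈(1 : ℝ) / 3 * (l1 + 2 * l2)⌉ : ℝ) / (l1 + 2 * l2))
        ((⌈(1 : ℝ) / 3 * (2 * l1 + l2)⌉ : ℝ) / (2 * l1 + l2)) := by
  have r1 : (0 : ℝ) < l1 := by exact_mod_cast h1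
  have r2 : (0 : ℝ) < l2 := by exact_mod_cast h2
  have ceil_bounds : ∀ n : ℤ, n ≤ 3 * ⌈(1 : ℝ) / 3 * n⌉ ∧ 3 * ⌈(1 : ℝ) / 3 * n⌉ < n + 3 :=
    fun n => by
      have b1 := Int.le_ceil ((1 : ℝ) / 3 * n)
      have b2 := Int.ceil_lt_add_one ((1 : ℝ) / 3 * n)
      constructor
      · have : (n : ℝ) ≤ 3 * ⌈(1 : ℝ) / 3 * n⌉ := by linarith
        exact_mod_cast this
      · have : (3 * ⌈(1 : ℝ) / 3 * n⌉ : ℝ) < n + 3 := by linarith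
        exact_mod_cast this
  have hp := ceil_bounds (l1 + 2 * l2)
  have hq := ceil_bounds (2 * l1 + l2)
  push_cast at hp hq
  have hco' : IsCoprime l1 l2 := Int.isCoprime_iff_gcd_eq_one.2 hco
  have hbdd : BddBelow (lowerDensity '' {A | SCovering ({0, l1, l1 + l2} : Set ℤ) A}) :=
    ⟨0, by rintro _ ⟨A, -, rfl⟩; exact lowerDensity_nonneg A⟩
  obtain ⟨A, hA, hAn, hAd⟩ := exists_periodic_mem_arithmetic_triple (n := l1 + 2 * l2) (g := l2)
    (by omega) (by simpa using hco'.symm.add_mul_right_right 2) hp.1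
  obtain ⟨B, hB, hBn, hBd⟩ := exists_periodic_mem_arithmetic_triple (n := 2 * l1 + l2) (g := l1)
    (by omega) (by simpa [add_comm] using hco'.add_mul_right_right 2) hq.1
  have hAcov : SCovering ({0, l1, l1 + l2} : Set ℤ) A := sCovering_triple_iff.2 fun t => by
    have e1 := hAn (t - l1 - l2)
    have e2 := hAn (t - l1)
    rw [show t - l1 - l2 + (l1 + 2 * l2) = t + l2 by ring] at e1
    rw [show t - l1 + (l1 + 2 * l2) = t + 2 * l2 by ring] at e2
    have := hA t
    tauto
  have hBcov : SCovering ({0, l1, l1 + l2} : Set ℤ) B := sCovering_triple_iff.2 fun t => by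
    have e := hBn (t - l1 - l2)
    have := hB (t - l1)
    rw [show t - l1 - l2 + (2 * l1 + l2) = t - l1 + 2 * l1 by ring] at e
    rw [show t - l1 + l1 = t by ring] at this
    tauto
  push_cast at hAd hBd
  refine le_antisymm (le_min ?_ ?_) ?_
  · exact (csInf_le hbdd ⟨A, hAcov, rfl⟩).trans hAd
  · exact (csInf_le hbdd ⟨B, hBcov, rfl⟩).trans hBd
  · refine le_csInf ⟨_, A, hAcov, rfl⟩ ?_
    rintro _ ⟨D, hD, rfl⟩
    exact le_lowerDensity_of_sCovering h1 h2 hp hq hD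
end
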